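/- Suppose ε_1⋯ε_m = −1. Then the counting function satisfies 𝒩_odd(M,K,ε) ≤ 1. Moreover: (i) if K_1+⋯+K_m is even then 𝒩_odd(M,K,ε) = 0; (ii) if K_1+⋯+K_m is odd and |K_1|+⋯+|K_m| ≤ 2M−1 then 𝒩_odd(M,K,ε) = 1. -/

import Mathlib

/-- `𝒩_odd(M,K,ε)`: the number of integer tuples `(n_1,…,n_m)` (here indexed by
`Fin (m+1)`, indices cyclic) with each `n_j` odd, `−(2M−1) ≤ n_j ≤ 2M−1`, and
`n_j − ε_{j−1} n_{j−1} = −2 K_j`. -/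
noncomputable def NcountOdd (M : ℕ) (m : ℕ) (ε K : Fin (m + 1) → ℤ) : ℕ :=
  Nat.card {n : Fin (m + 1) → ℤ //
    (∀ j, Odd (n j)) ∧
    (∀ j, -(2 * (M : ℤ) - 1) ≤ n j ∧ n j ≤ 2 * (M : ℤ) - 1) ∧
    (∀ j, n j - ε (j - 1) * n (j - 1) = -(2 * K j))}

/-- The inhomogeneous part of the `r`-step iterate, started at `j`, of the affine recurrence
`x_{i+1} = ε_i x_i + K_{i+1}`. -/
def affineIterate {R : Type*} [CommRing R] (ε K : R → ℤ) (j : R) : ℕ → ℤ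
  | 0 => 0
  | r + 1 => ε (j + r) * affineIterate ε K j r + K (j + r + 1)

theorem affineIterate_succ_left {R : Type*} [CommRing R] (ε K : R → ℤ) (j : R) (r : ℕ) :
    affineIterate ε K j (r + 1) =
      (∏ i ∈ Finset.range r, ε (j + 1 + i)) * K (j + 1) + affineIterate ε K (j + 1) r := by
  induction r with
  | zero => simp [affineIterate]
  | succ r ih =>
    rw [affineIterate, ih, Finset.prod_range_succ, affineIterate]
    have h : j + ((r + 1 : ℕ) : R) = j + 1 + r := by push_cast; ring
    rw [h]
    ring

theorem abs_affineIterate_le {R : Type*} [CommRing R] (ε K : R → ℤ)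
    (hε : ∀ j, ε j = 1 ∨ ε j = -1) (j : R) (r : ℕ) :
    |affineIterate ε K j r| ≤ ∑ i ∈ Finset.range r, |K (j + 1 + i)| := by
  induction r with
  | zero => simp [affineIterate]
  | succ r ih =>
    rw [affineIterate, Finset.sum_range_succ, add_right_comm j (r : R) 1]
    refine (abs_add_le _ _).trans (add_le_add_left ?_ _)
    rcases hε (j + r) with h | h <;> simpa [h] using ih

theorem even_affineIterate_sub_sum {R : Type*} [CommRing R] (ε K : R → ℤ)
    (hε : ∀ j, ε j = 1 ∨ ε j = -1) (j : R) (r : ℕ) :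
    Even (affineIterate ε K j r - ∑ i ∈ Finset.range r, K (j + 1 + i)) := by
  induction r with
  | zero => simp [affineIterate]
  | succ r ih =>
    rw [affineIterate, Finset.sum_range_succ, add_right_comm j (r : R) 1]
    rcases hε (j + r) with h | h <;> rw [h] <;> grind

theorem solution_add_natCast {R : Type*} [CommRing R] {ε K n : R → ℤ}
    (hn : ∀ j, n j - ε (j - 1) * n (j - 1) = -(2 * K j)) (j : R) (r : ℕ) :
    n (j + r) = (∏ i ∈ Finset.range r, ε (j + i)) * n j - 2 * affineIterate ε K j r := by
  induction r with
  | zero => simp [affineIterate]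
  | succ r ih =>
    have h := hn (j + r + 1)
    rw [add_sub_cancel_right] at h
    rw [affineIterate, Finset.prod_range_succ, Nat.cast_succ, ← add_assoc]
    rw [ih] at h
    linear_combination h

open scoped Fin.CommRing in
theorem Fin.prod_range_add_natCast {α : Type*} [CommMonoid α] {m : ℕ} (f : Fin (m + 1) → α)
    (j : Fin (m + 1)) : ∏ i ∈ Finset.range (m + 1), f (j + (i : Fin (m + 1))) = ∏ i, f i := by
  rw [Finset.prod_range]
  simp only [Fin.cast_val_eq_self]
  exact Equiv.prod_comp (Equiv.addLeft j) f

open scoped Fin.CommRing in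
theorem Fin.sum_range_add_natCast {α : Type*} [AddCommMonoid α] {m : ℕ} (f : Fin (m + 1) → α)
    (j : Fin (m + 1)) : ∑ i ∈ Finset.range (m + 1), f (j + (i : Fin (m + 1))) = ∑ i, f i :=
  Fin.prod_range_add_natCast (α := Multiplicative α) f j

open scoped Fin.CommRing in
/-- When the signs multiply to `-1`, the cyclic system has exactly one integral solution. -/
theorem cyclic_system_iff {m : ℕ} {ε K : Fin (m + 1) → ℤ} (hprod : (∏ j, ε j) = -1)
    (n : Fin (m + 1) → ℤ) :
    (∀ j, n j - ε (j - 1) * n (j - 1) = -(2 * K j)) ↔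
      n = fun j => -affineIterate ε K j (m + 1) := by
  have hcast : ((m + 1 : ℕ) : Fin (m + 1)) = 0 := by simp
  constructor
  · intro hn
    funext j
    have h := solution_add_natCast hn j (m + 1)
    rw [Fin.prod_range_add_natCast, hprod, hcast, add_zero] at h
    linarith
  · rintro rfl j
    obtain ⟨j, rfl⟩ : ∃ i, j = i + 1 := ⟨j - 1, by simp⟩
    have h := affineIterate_succ_left ε K j (m + 1)
    rw [Fin.prod_range_add_natCast, hprod, affineIterate, hcast, add_zero] at h
    simp only [add_sub_cancel_right]
    linear_combination h

open scoped Fin.CommRing in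
theorem abs_affineIterate_le_sum {m : ℕ} {ε : Fin (m + 1) → ℤ} (K : Fin (m + 1) → ℤ)
    (hε : ∀ j, ε j = 1 ∨ ε j = -1) (j : Fin (m + 1)) :
    |affineIterate ε K j (m + 1)| ≤ ∑ i, |K i| := by
  simpa only [Fin.sum_range_add_natCast (fun i => |K i|)] using
    abs_affineIterate_le ε K hε j (m + 1)

open scoped Fin.CommRing in
theorem odd_affineIterate_iff {m : ℕ} {ε : Fin (m + 1) → ℤ} (K : Fin (m + 1) → ℤ)
    (hε : ∀ j, ε j = 1 ∨ ε j = -1) (j : Fin (m + 1)) :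
    Odd (affineIterate ε K j (m + 1)) ↔ Odd (∑ i, K i) := by
  have h := even_affineIterate_sub_sum ε K hε j (m + 1)
  rw [Fin.sum_range_add_natCast K, Int.even_sub] at h
  rw [← Int.not_even_iff_odd, ← Int.not_even_iff_odd, h]

/-- **Counting lemma, odd version (Lemma 8 of Hughes–Rudnick):** if `ε₁⋯ε_m = −1` then
`𝒩_odd(M,K,ε) ≤ 1`; it vanishes when `∑ K_j` is even, and equals `1` when `∑ K_j` is
odd and `∑ |K_j| ≤ 2M − 1`. -/
theorem counting_lemma_odd (M : ℕ) (hM : 1 ≤ M) (m : ℕ) (ε K : Fin (m + 1) → ℤ)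
    (hε : ∀ j, ε j = 1 ∨ ε j = -1) (hprod : (∏ j, ε j) = -1) :
    NcountOdd M m ε K ≤ 1 ∧
    (Even (∑ j, K j) → NcountOdd M m ε K = 0) ∧
    (Odd (∑ j, K j) → (∑ j, |K j|) ≤ 2 * (M : ℤ) - 1 → NcountOdd M m ε K = 1) := by
  have hle : NcountOdd M m ε K ≤ 1 := by
    have : Subsingleton {n : Fin (m + 1) → ℤ //
        (∀ j, Odd (n j)) ∧
        (∀ j, -(2 * (M : ℤ) - 1) ≤ n j ∧ n j ≤ 2 * (M : ℤ) - 1) ∧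
        (∀ j, n j - ε (j - 1) * n (j - 1) = -(2 * K j))} := by
      refine ⟨?_⟩
      rintro ⟨n, _, _, hn⟩ ⟨n', _, _, hn'⟩
      rw [cyclic_system_iff hprod] at hn hn'
      exact Subtype.ext (hn.trans hn'.symm)
    exact Finite.card_le_one_iff_subsingleton.2 this
  refine ⟨hle, fun heven => ?_, fun hodd hbound => ?_⟩
  · have : IsEmpty {n : Fin (m + 1) → ℤ //
        (∀ j, Odd (n j)) ∧
        (∀ j, -(2 * (M : ℤ) - 1) ≤ n j ∧ n j ≤ 2 * (M : ℤ) - 1) ∧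
        (∀ j, n j - ε (j - 1) * n (j - 1) = -(2 * K j))} := by
      refine ⟨?_⟩
      rintro ⟨n, hn_odd, _, hn⟩
      rw [cyclic_system_iff hprod] at hn
      have h := hn_odd 0
      rw [hn, odd_neg, odd_affineIterate_iff K hε] at h
      exact Int.not_even_iff_odd.2 h heven
    exact Nat.card_of_isEmpty
  · refine Nat.card_eq_one_iff_exists.2
      ⟨⟨_, fun j => ?_, fun j => ?_, (cyclic_system_iff hprod _).2 rfl⟩, ?_⟩
    · exact ((odd_affineIterate_iff K hε j).2 hodd).neg
    · exact abs_le.1 ((abs_neg _).trans_le ((abs_affineIterate_le_sum K hε j).trans hbound))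
    · rintro ⟨n, _, _, hn⟩
      exact Subtype.ext ((cyclic_system_iff hprod n).1 hn)
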